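/- arXiv:2410.21636 — 5 statements merged into one kernel-verified Lean document; each statement's English description precedes it below -/
import Mathlib

section
/- Let 0 < γ ≤ 1, let A = diag(γ, 2γ, 1) ∈ ℝ^{3×3}, and let z* = (x*, y*) with x* = y* = (1/(3+2γ))·(2, 1, 2γ) ∈ Δ³. If κ ≥ 0 is such that Φ(z) ≥ κ·‖z − z*‖ for every z = (x, y) ∈ Δ³ × Δ³, where ‖·‖ is the Euclidean norm on ℝ⁶, then κ ≤ 2γ. (In particular, the error-bound modulus of a 3×3 zero-sum game can be arbitrarily close to 0.) -/
/-- For `0 < γ ≤ 1` and `A = diag(γ, 2γ, 1)` with equilibrium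
`z* = (x*, x*)`, `x* = (1/(3+2γ))·(2, 1, 2γ)`, any error-bound modulus `κ ≥ 0`
satisfying `Φ(z) ≥ κ·‖z − z*‖` for all `z ∈ Δ³ × Δ³` must satisfy `κ ≤ 2γ`. -/
theorem stmt_1 (γ : ℝ) (hγ0 : 0 < γ) (hγ1 : γ ≤ 1)
    (A : Matrix (Fin 3) (Fin 3) ℝ) (hA : A = Matrix.diagonal ![γ, 2 * γ, 1])
    (xs : Fin 3 → ℝ) (hxs : xs = fun i => (1 / (3 + 2 * γ)) * ![2, 1, 2 * γ] i)
    (κ : ℝ) (hκ0 : 0 ≤ κ)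
    (hκ : ∀ x ∈ stdSimplex ℝ (Fin 3), ∀ y ∈ stdSimplex ℝ (Fin 3),
      κ * Real.sqrt ((∑ i, (x i - xs i) ^ 2) + ∑ j, (y j - xs j) ^ 2) ≤
        sSup ((fun y' => ∑ i, ∑ j, x i * A i j * y' j) '' stdSimplex ℝ (Fin 3)) -
          sInf ((fun x' => ∑ i, ∑ j, x' i * A i j * y j) '' stdSimplex ℝ (Fin 3))) :
    κ ≤ 2 * γ := by
  subst hA hxs
  have hd : 0 < 3 + 2 * γ := by linarith
  have hxs : (fun i => (1 / (3 + 2 * γ)) * ![2, 1, 2 * γ] i) ∈ stdSimplex ℝ (Fin 3) := by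
    refine ⟨fun i => ?_, ?_⟩
    · fin_cases i <;> simp <;> positivity
    · simp [Fin.sum_univ_three]
      field_simp
      ring
  have he : (![1, 0, 0] : Fin 3 → ℝ) ∈ stdSimplex ℝ (Fin 3) := by
    refine ⟨fun i => ?_, ?_⟩
    · fin_cases i <;> simp
    · simp [Fin.sum_univ_three]
  have h := hκ _ hxs _ he
  have hsup : sSup ((fun y' : Fin 3 → ℝ => ∑ i, ∑ j, (1 / (3 + 2 * γ)) * ![2, 1, 2 * γ] i *
      Matrix.diagonal ![γ, 2 * γ, 1] i j * y' j) '' stdSimplex ℝ (Fin 3)) ≤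
      2 * γ / (3 + 2 * γ) := by
    refine Real.sSup_le ?_ (by positivity)
    rintro _ ⟨y, ⟨-, hy⟩, rfl⟩
    rw [Fin.sum_univ_three] at hy
    have : y 0 = 1 - y 1 - y 2 := by linarith
    simp [Fin.sum_univ_three, Matrix.diagonal, this]
    apply le_of_eq
    field_simp
    ring
  have hinf : 0 ≤ sInf ((fun x' : Fin 3 → ℝ => ∑ i, ∑ j, x' i *
      Matrix.diagonal ![γ, 2 * γ, 1] i j * (![1, 0, 0] : Fin 3 → ℝ) j) ''
        stdSimplex ℝ (Fin 3)) := by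
    refine Real.sInf_nonneg ?_
    rintro _ ⟨x, ⟨hx, -⟩, rfl⟩
    have := mul_nonneg (hx 0) hγ0.le
    simpa [Fin.sum_univ_three, Matrix.diagonal] using this
  have hdist : 1 / (3 + 2 * γ) ≤ Real.sqrt
      ((∑ i, ((1 / (3 + 2 * γ)) * ![2, 1, 2 * γ] i - (1 / (3 + 2 * γ)) * ![2, 1, 2 * γ] i) ^ 2) +
        ∑ j, ((![1, 0, 0] : Fin 3 → ℝ) j - (1 / (3 + 2 * γ)) * ![2, 1, 2 * γ] j) ^ 2) := by
    apply Real.le_sqrt_of_sq_le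
    simp [Fin.sum_univ_three]
    have := sq_nonneg (1 - (3 + 2 * γ)⁻¹ * 2)
    have := sq_nonneg ((3 + 2 * γ)⁻¹ * (2 * γ))
    nlinarith
  have hle : κ * (1 / (3 + 2 * γ)) ≤ 2 * γ / (3 + 2 * γ) := by
    have := mul_le_mul_of_nonneg_left hdist hκ0
    linarith
  rwa [mul_one_div, div_le_div_iff_of_pos_right hd] at hle
end

section
/- Let μ be a probability measure on ℝ that has a density ρ with respect to Lebesgue measure. Suppose there exist δ > 0 and c ∈ (0, 1] such that for all t, t' with 0 ≤ t ≤ t' ≤ δ one has ρ(t') ≥ c·ρ(t). Then for every ε ≥ 0, μ({x : 0 ≤ x ≤ ε}) ≤ (ε/(c·δ)) · μ({x : x ≥ 0}). (Equivalently, for a random variable X with density ρ, P[X ≤ ε | X ≥ 0] ≤ ε/(cδ) whenever P[X ≥ 0] > 0.) -/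
open MeasureTheory

/-- Linear change of variables `t = a * s` on the interval `[0, a * δ]`. -/
lemma setLIntegral_Icc_zero_mul {f : ℝ → ENNReal} (hf : Measurable f) {a : ℝ} (ha : 0 < a)
    (δ : ℝ) :
    ∫⁻ t in Set.Icc 0 (a * δ), f t = ENNReal.ofReal a * ∫⁻ s in Set.Icc 0 δ, f (a * s) := by
  have hpre : (fun s => a * s) ⁻¹' Set.Icc 0 (a * δ) = Set.Icc 0 δ := by
    ext s
    simp [mul_nonneg_iff_of_pos_left ha, mul_le_mul_iff_right₀ ha]
  conv_lhs => rw [← Real.smul_map_volume_mul_left ha.ne']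
  rw [Measure.restrict_smul, lintegral_smul_measure,
    setLIntegral_map measurableSet_Icc hf (measurable_const_mul a), hpre, abs_of_pos ha,
    smul_eq_mul]

/-- if a probability measure `μ` on `ℝ` has a density `ρ` w.r.t.
Lebesgue measure such that `ρ(t') ≥ c·ρ(t)` whenever `0 ≤ t ≤ t' ≤ δ`, then for
every `ε ≥ 0`, `μ([0, ε]) ≤ (ε/(cδ))·μ([0, ∞))`. -/
theorem stmt_7 (μ : Measure ℝ) [IsProbabilityMeasure μ]
    (ρ : ℝ → ℝ) (hρ0 : ∀ t, 0 ≤ ρ t) (hρm : Measurable ρ)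
    (hμ : μ = volume.withDensity fun t => ENNReal.ofReal (ρ t))
    (δ : ℝ) (hδ : 0 < δ) (c : ℝ) (hc0 : 0 < c) (hc1 : c ≤ 1)
    (h : ∀ t t' : ℝ, 0 ≤ t → t ≤ t' → t' ≤ δ → c * ρ t ≤ ρ t') :
    ∀ ε : ℝ, 0 ≤ ε →
      μ {x | 0 ≤ x ∧ x ≤ ε} ≤ ENNReal.ofReal (ε / (c * δ)) * μ {x | 0 ≤ x} := by
  intro ε hε
  change μ (Set.Icc 0 ε) ≤ _ * μ (Set.Ici 0)
  rcases le_or_gt δ ε with hδε | hεδ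
  · have hone : 1 ≤ ENNReal.ofReal (ε / (c * δ)) := by
      rw [ENNReal.one_le_ofReal, one_le_div (mul_pos hc0 hδ)]
      nlinarith
    exact (measure_mono Set.Icc_subset_Ici_self).trans (le_mul_of_one_le_left' hone)
  rcases hε.eq_or_lt with rfl | hε
  · have hac : μ ≪ volume := hμ ▸ withDensity_absolutelyContinuous _ _
    simp [hac Real.volume_singleton]
  have ha : 0 < ε / δ := div_pos hε hδ
  have hdom : ∀ s ∈ Set.Icc 0 δ,
      ENNReal.ofReal (ρ (ε / δ * s)) ≤ ENNReal.ofReal c⁻¹ * ENNReal.ofReal (ρ s) := by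
    intro s hs
    rw [← ENNReal.ofReal_mul (inv_nonneg.2 hc0.le)]
    refine ENNReal.ofReal_le_ofReal ((le_inv_mul_iff₀ hc0).2 ?_)
    exact h _ _ (mul_nonneg ha.le hs.1)
      (mul_le_of_le_one_left hs.1 ((div_le_one hδ).2 hεδ.le)) hs.2
  have hm : Measurable fun t => ENNReal.ofReal (ρ t) := hρm.ennreal_ofReal
  calc μ (Set.Icc 0 ε)
      = ∫⁻ t in Set.Icc 0 (ε / δ * δ), ENNReal.ofReal (ρ t) := by
        rw [hμ, withDensity_apply _ measurableSet_Icc, div_mul_cancel₀ _ hδ.ne']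
    _ = ENNReal.ofReal (ε / δ) * ∫⁻ s in Set.Icc 0 δ, ENNReal.ofReal (ρ (ε / δ * s)) :=
        setLIntegral_Icc_zero_mul hm ha δ
    _ ≤ ENNReal.ofReal (ε / δ) *
          ∫⁻ s in Set.Icc 0 δ, ENNReal.ofReal c⁻¹ * ENNReal.ofReal (ρ s) := by
        gcongr 1
        exact setLIntegral_mono' measurableSet_Icc hdom
    _ = ENNReal.ofReal (ε / (c * δ)) * μ (Set.Icc 0 δ) := by
        rw [lintegral_const_mul _ hm, ← mul_assoc, ← ENNReal.ofReal_mul ha.le, hμ,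
          withDensity_apply _ measurableSet_Icc]
        congr 2
        field_simp
    _ ≤ ENNReal.ofReal (ε / (c * δ)) * μ (Set.Ici 0) := by
        gcongr
        exact Set.Icc_subset_Ici_self
end

section
/- Let B and N be finite nonempty types with distinguished elements i₀ ∈ B and j₀ ∈ N. Define the linear endomorphism S of the space of real B×N matrices by: (S A)_{i,j} = A_{i,j} − A_{i₀,j} − A_{i,j₀} + A_{i₀,j₀} if i ≠ i₀ and j ≠ j₀; (S A)_{i,j₀} = A_{i₀,j₀} − A_{i,j₀} if i ≠ i₀; (S A)_{i₀,j} = A_{i₀,j₀} − A_{i₀,j} if j ≠ j₀; and (S A)_{i₀,j₀} = A_{i₀,j₀}. Then S is a linear bijection and |det S| = 1. -/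
/-- the change-of-variables map `S` on `B×N` real matrices, defined by
`(S A)_{i,j} = A_{i,j} − A_{i₀,j} − A_{i,j₀} + A_{i₀,j₀}` for `i ≠ i₀, j ≠ j₀`,
`(S A)_{i,j₀} = A_{i₀,j₀} − A_{i,j₀}` for `i ≠ i₀`,
`(S A)_{i₀,j} = A_{i₀,j₀} − A_{i₀,j}` for `j ≠ j₀`, and `(S A)_{i₀,j₀} = A_{i₀,j₀}`,
is a linear bijection with `|det S| = 1`. -/
theorem stmt_11 {B N : Type*} [Fintype B] [Fintype N] [DecidableEq B] [DecidableEq N]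
    [Nonempty B] [Nonempty N] (i₀ : B) (j₀ : N)
    (f : Matrix B N ℝ → Matrix B N ℝ)
    (hf : ∀ (A : Matrix B N ℝ) (i : B) (j : N),
      f A i j =
        if i = i₀ then
          (if j = j₀ then A i₀ j₀ else A i₀ j₀ - A i₀ j)
        else
          (if j = j₀ then A i₀ j₀ - A i j₀ else A i j - A i₀ j - A i j₀ + A i₀ j₀)) :
    ∃ S : Matrix B N ℝ →ₗ[ℝ] Matrix B N ℝ,
      ⇑S = f ∧ Function.Bijective S ∧ |LinearMap.det S| = 1 := by
  let S : Matrix B N ℝ →ₗ[ℝ] Matrix B N ℝ :=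
    { toFun := f
      map_add' := fun A A' => by
        ext i j
        simp only [hf, Matrix.add_apply]
        split_ifs <;> ring
      map_smul' := fun c A => by
        ext i j
        simp only [hf, Matrix.smul_apply, smul_eq_mul, RingHom.id_apply]
        split_ifs <;> ring }
  have hinv : Function.Involutive f := fun A => by
    ext i j
    by_cases hi : i = i₀ <;> by_cases hj : j = j₀ <;> simp only [hf, hi, hj, if_true, if_false] <;>
      ring
  have hcomp : S ∘ₗ S = LinearMap.id := LinearMap.ext hinv
  refine ⟨S, rfl, hinv.bijective, ?_⟩
  have hdet : LinearMap.det S * LinearMap.det S = 1 := by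
    rw [← LinearMap.det_comp, hcomp, LinearMap.det_id]
  rcases mul_self_eq_one_iff.mp hdet with h | h <;> simp [h]
end

section
/- Let A ∈ ℝ^{n×m} and z = (x, y) ∈ Δ^n × Δ^m, and let F(z) := (A y, −Aᵀ x) ∈ ℝ^{n+m}. Then there exists z' ∈ Δ^n × Δ^m such that ⟨F(z), z − z'⟩ ≥ (Φ(z)/2) · ‖z − z'‖, where ⟨·,·⟩ and ‖·‖ are the Euclidean inner product and norm on ℝ^{n+m}. (Hence the error bound with modulus κ implies saddle-point metric subregularity with modulus κ/2: sup_{z'∈Δ^n×Δ^m, z'≠z} ⟨F(z), z − z'⟩/‖z − z'‖ ≥ Φ(z)/2.) -/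
/-- Two points of the probability simplex are at squared Euclidean distance at most `2`. -/
theorem sum_sq_sub_le_two_of_mem_stdSimplex {ι : Type*} [Fintype ι] {x x' : ι → ℝ}
    (hx : x ∈ stdSimplex ℝ ι) (hx' : x' ∈ stdSimplex ℝ ι) :
    ∑ i, (x i - x' i) ^ 2 ≤ 2 := by
  have h : ∑ i, (x i - x' i) ^ 2 ≤ ∑ i, (x i + x' i) := by
    refine Finset.sum_le_sum fun i _ => ?_
    have h₁ := mem_Icc_of_mem_stdSimplex hx i
    have h₂ := mem_Icc_of_mem_stdSimplex hx' i
    nlinarith [h₁.1, h₁.2, h₂.1, h₂.2, mul_nonneg h₁.1 h₂.1]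
  rw [Finset.sum_add_distrib, hx.2, hx'.2] at h
  linarith


/-- for any `z = (x, y) ∈ Δⁿ × Δᵐ` and `F(z) = (A y, −Aᵀ x)`, there is
`z' = (x', y') ∈ Δⁿ × Δᵐ` with `⟨F(z), z − z'⟩ ≥ (Φ(z)/2)·‖z − z'‖`. -/
theorem stmt_13 (n m : ℕ) (A : Matrix (Fin n) (Fin m) ℝ)
    (x : Fin n → ℝ) (y : Fin m → ℝ)
    (hx : x ∈ stdSimplex ℝ (Fin n)) (hy : y ∈ stdSimplex ℝ (Fin m)) :
    ∃ x' ∈ stdSimplex ℝ (Fin n), ∃ y' ∈ stdSimplex ℝ (Fin m),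
      ((sSup ((fun y'' => ∑ i, ∑ j, x i * A i j * y'' j) '' stdSimplex ℝ (Fin m)) -
          sInf ((fun x'' => ∑ i, ∑ j, x'' i * A i j * y j) '' stdSimplex ℝ (Fin n))) / 2) *
        Real.sqrt ((∑ i, (x i - x' i) ^ 2) + ∑ j, (y j - y' j) ^ 2) ≤
      (∑ i, (∑ j, A i j * y j) * (x i - x' i)) +
        ∑ j, (-(∑ i, A i j * x i)) * (y j - y' j) := by
  obtain ⟨y', hy', hsup, hmax⟩ := (isCompact_stdSimplex ℝ (Fin m)).exists_sSup_image_eq_and_ge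
    ⟨y, hy⟩ (f := fun y'' => ∑ i, ∑ j, x i * A i j * y'' j) (by fun_prop)
  obtain ⟨x', hx', hinf, hmin⟩ := (isCompact_stdSimplex ℝ (Fin n)).exists_sInf_image_eq_and_le
    ⟨x, hx⟩ (f := fun x'' => ∑ i, ∑ j, x'' i * A i j * y j) (by fun_prop)
  refine ⟨x', hx', y', hy', ?_⟩
  rw [hsup, hinf]
  have hgap : (∑ i, (∑ j, A i j * y j) * (x i - x' i)) +
        ∑ j, (-(∑ i, A i j * x i)) * (y j - y' j) =
      (∑ i, ∑ j, x i * A i j * y' j) - ∑ i, ∑ j, x' i * A i j * y j := by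
    simp only [← Finset.sum_neg_distrib, Finset.sum_mul]
    rw [Finset.sum_comm (s := (Finset.univ : Finset (Fin m)))]
    simp only [← Finset.sum_add_distrib, ← Finset.sum_sub_distrib]
    exact Finset.sum_congr rfl fun i _ => Finset.sum_congr rfl fun j _ => by ring
  have hnorm : Real.sqrt ((∑ i, (x i - x' i) ^ 2) + ∑ j, (y j - y' j) ^ 2) ≤ 2 := by
    refine Real.sqrt_le_iff.2 ⟨by norm_num, ?_⟩
    linarith [sum_sq_sub_le_two_of_mem_stdSimplex hx hx',
      sum_sq_sub_le_two_of_mem_stdSimplex hy hy']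
  have hnonneg := (hmin x hx).trans (hmax y hy)
  rw [hgap]
  nlinarith
end

section
/- Let A ∈ ℝ^{n×m} be the payoff matrix of a non-degenerate zero-sum game with unique equilibrium (x*, y*), value v, supports B := {i : x*_i > 0} and N := {j : y*_j > 0}, and suppose N ≠ [m] (so N̄ := [m]∖N is nonempty). Suppose the game is δ-support-stable for some δ > 0, meaning: for every A' ∈ ℝ^{n×m} with ‖A − A'‖ ≤ δ (spectral norm), the game with payoff A' is non-degenerate and its unique equilibrium has supports exactly B and N. Then δ ≤ √n · β_P(A), where β_P(A) := min_{j∈N̄} (v − ⟨x*_B, A_{B,j}⟩). -/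
open scoped Classical

noncomputable section

/-- The bilinear payoff `⟨x, A y⟩`. -/
def pay {n m : ℕ} (A : Matrix (Fin n) (Fin m) ℝ) (x : Fin n → ℝ) (y : Fin m → ℝ) : ℝ :=
  ∑ i, ∑ j, x i * A i j * y j

/-- `(xs, ys)` is an equilibrium (saddle point) of the zero-sum game with payoff `A`. -/
def IsSaddle {n m : ℕ} (A : Matrix (Fin n) (Fin m) ℝ) (xs : Fin n → ℝ) (ys : Fin m → ℝ) :
    Prop :=
  xs ∈ stdSimplex ℝ (Fin n) ∧ ys ∈ stdSimplex ℝ (Fin m) ∧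
    ∀ x ∈ stdSimplex ℝ (Fin n), ∀ y ∈ stdSimplex ℝ (Fin m),
      pay A xs y ≤ pay A xs ys ∧ pay A xs ys ≤ pay A x ys

/-- The game with payoff `A` is non-degenerate, with (unique) equilibrium `(xs, ys)`:
exactly `n` of the conditions `{xs i = 0} ∪ {⟨xs, A_{:,j}⟩ = v}` hold, and
exactly `m` of the conditions `{ys j = 0} ∪ {⟨A_{i,:}, ys⟩ = v}` hold. -/
def NonDegenerate {n m : ℕ} (A : Matrix (Fin n) (Fin m) ℝ) (xs : Fin n → ℝ)
    (ys : Fin m → ℝ) : Prop :=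
  IsSaddle A xs ys ∧
  (∀ x' y', IsSaddle A x' y' → x' = xs ∧ y' = ys) ∧
  ((Finset.univ.filter fun i : Fin n => xs i = 0).card
      + (Finset.univ.filter fun j : Fin m => (∑ i, xs i * A i j) = pay A xs ys).card = n) ∧
  ((Finset.univ.filter fun j : Fin m => ys j = 0).card
      + (Finset.univ.filter fun i : Fin n => (∑ j, A i j * ys j) = pay A xs ys).card = m)

/-- The spectral (ℓ₂ operator) norm of a rectangular real matrix. -/
def specNorm {n m : ℕ} (M : Matrix (Fin n) (Fin m) ℝ) : ℝ :=
  ‖LinearMap.toContinuousLinearMap (Matrix.toEuclideanLin M)‖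

/-- Minimum of `f` over the finite set `s`, with the convention that the minimum over
an empty index set equals `1`. -/
def minD {ι : Type*} (s : Finset ι) (f : ι → ℝ) : ℝ :=
  if h : s.Nonempty then s.inf' h f else 1

theorem pay_eq_sum_col {n m : ℕ} (A : Matrix (Fin n) (Fin m) ℝ) (x : Fin n → ℝ)
    (y : Fin m → ℝ) : pay A x y = ∑ j, y j * ∑ i, x i * A i j := by
  unfold pay
  rw [Finset.sum_comm]
  refine Finset.sum_congr rfl fun j _ => ?_
  rw [Finset.mul_sum]
  exact Finset.sum_congr rfl fun i _ => by ring

theorem pay_eq_sum_row {n m : ℕ} (A : Matrix (Fin n) (Fin m) ℝ) (x : Fin n → ℝ)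
    (y : Fin m → ℝ) : pay A x y = ∑ i, x i * ∑ j, A i j * y j := by
  unfold pay
  refine Finset.sum_congr rfl fun i _ => ?_
  rw [Finset.mul_sum]
  exact Finset.sum_congr rfl fun j _ => by ring

theorem IsSaddle.col_le {n m : ℕ} {A : Matrix (Fin n) (Fin m) ℝ} {xs : Fin n → ℝ}
    {ys : Fin m → ℝ} (h : IsSaddle A xs ys) (j : Fin m) :
    ∑ i, xs i * A i j ≤ pay A xs ys := by
  have := (h.2.2 xs h.1 _ (single_mem_stdSimplex ℝ j)).1
  rw [pay_eq_sum_col A xs (Pi.single j 1)] at this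
  simpa [Pi.single_apply] using this

theorem IsSaddle.le_row {n m : ℕ} {A : Matrix (Fin n) (Fin m) ℝ} {xs : Fin n → ℝ}
    {ys : Fin m → ℝ} (h : IsSaddle A xs ys) (i : Fin n) :
    pay A xs ys ≤ ∑ j, A i j * ys j := by
  have := (h.2.2 _ (single_mem_stdSimplex ℝ i) ys h.2.1).2
  rw [pay_eq_sum_row A (Pi.single i 1) ys] at this
  simpa [Pi.single_apply] using this

/-- A weighted average of numbers bounded by `v` that equals `v` has every entry of positive
weight equal to `v`. -/
theorem eq_of_sum_mul_eq_of_le {ι : Type*} [Fintype ι] {w c : ι → ℝ} {v : ℝ}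
    (hw : w ∈ stdSimplex ℝ ι) (hc : ∀ k, c k ≤ v) (hv : ∑ k, w k * c k = v) {k : ι}
    (hk : w k ≠ 0) : c k = v := by
  have h0 : ∑ k, w k * (v - c k) = 0 := by
    simp only [mul_sub, Finset.sum_sub_distrib, ← Finset.sum_mul, hw.2, hv, one_mul, sub_self]
  rw [Finset.sum_eq_zero_iff_of_nonneg
    fun k _ => mul_nonneg (hw.1 k) (sub_nonneg.2 (hc k))] at h0
  rcases mul_eq_zero.1 (h0 k (Finset.mem_univ k)) with h | h
  · exact absurd h hk
  · linarith

theorem IsSaddle.col_eq {n m : ℕ} {A : Matrix (Fin n) (Fin m) ℝ} {xs : Fin n → ℝ}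
    {ys : Fin m → ℝ} (h : IsSaddle A xs ys) {j : Fin m} (hj : ys j ≠ 0) :
    ∑ i, xs i * A i j = pay A xs ys :=
  eq_of_sum_mul_eq_of_le h.2.1 h.col_le (pay_eq_sum_col A xs ys).symm hj

theorem IsSaddle.row_eq {n m : ℕ} {A : Matrix (Fin n) (Fin m) ℝ} {xs : Fin n → ℝ}
    {ys : Fin m → ℝ} (h : IsSaddle A xs ys) {i : Fin n} (hi : xs i ≠ 0) :
    ∑ j, A i j * ys j = pay A xs ys := by
  have := eq_of_sum_mul_eq_of_le (c := fun i => -∑ j, A i j * ys j) (v := -pay A xs ys) h.1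
    (fun k => neg_le_neg (h.le_row k))
    (by simp only [mul_neg, Finset.sum_neg_distrib, ← pay_eq_sum_row]) hi
  exact neg_injective this

/-- Strict complementarity: in a non-degenerate game every tight column is in the support. -/
theorem NonDegenerate.ne_zero_of_col_eq {n m : ℕ} {A : Matrix (Fin n) (Fin m) ℝ}
    {xs : Fin n → ℝ} {ys : Fin m → ℝ} (h : NonDegenerate A xs ys) {j : Fin m}
    (hj : ∑ i, xs i * A i j = pay A xs ys) : ys j ≠ 0 := by
  obtain ⟨hs, -, hx, hy⟩ := h
  have hB : (Finset.univ.filter fun i : Fin n => ¬ xs i = 0) ⊆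
      Finset.univ.filter fun i : Fin n => (∑ j, A i j * ys j) = pay A xs ys := fun i hi => by
    simpa using hs.row_eq (Finset.mem_filter.1 hi).2
  have hN : (Finset.univ.filter fun j : Fin m => ¬ ys j = 0) ⊆
      Finset.univ.filter fun j : Fin m => (∑ i, xs i * A i j) = pay A xs ys := fun j hj => by
    simpa using hs.col_eq (Finset.mem_filter.1 hj).2
  have hxc := Finset.card_filter_add_card_filter_not
    (s := (Finset.univ : Finset (Fin n))) (fun i => xs i = 0)
  have hyc := Finset.card_filter_add_card_filter_not
    (s := (Finset.univ : Finset (Fin m))) (fun j => ys j = 0)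
  have hBc := Finset.card_le_card hB
  simp only [Finset.card_univ, Fintype.card_fin] at hxc hyc
  have hEq := Finset.eq_of_subset_of_card_le hN (by lia)
  have hmem : j ∈ Finset.univ.filter fun j : Fin m => (∑ i, xs i * A i j) = pay A xs ys := by
    simpa using hj
  rw [← hEq] at hmem
  exact (Finset.mem_filter.1 hmem).2

/-- The matrix with all entries of column `j` equal to `t` and zeros elsewhere. -/
def constCol (n : ℕ) {m : ℕ} (j : Fin m) (t : ℝ) : Matrix (Fin n) (Fin m) ℝ :=
  fun _ k => if k = j then t else 0

theorem specNorm_neg_constCol_le (n : ℕ) {m : ℕ} (j : Fin m) {t : ℝ} (ht : 0 ≤ t) :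
    specNorm (-constCol n j t) ≤ Real.sqrt n * t := by
  refine ContinuousLinearMap.opNorm_le_bound _ (by positivity) fun y => ?_
  have hy : ∀ i, (Matrix.toEuclideanLin (-constCol n j t) y) i = -(t * y j) := fun i => by
    simp [Matrix.toLpLin_apply, Matrix.mulVec, dotProduct, constCol]
  have hyj : ‖y j‖ ≤ ‖y‖ := PiLp.norm_apply_le y j
  rw [LinearMap.coe_toContinuousLinearMap', EuclideanSpace.norm_eq]
  simp only [hy, norm_neg, norm_mul, Finset.sum_const, Finset.card_univ, Fintype.card_fin,
    nsmul_eq_mul, Real.norm_of_nonneg ht]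
  rw [Real.sqrt_mul (Nat.cast_nonneg n), Real.sqrt_sq (by positivity), mul_assoc]
  gcongr

theorem col_add_constCol {n m : ℕ} (A : Matrix (Fin n) (Fin m) ℝ) {x : Fin n → ℝ}
    (hx : x ∈ stdSimplex ℝ (Fin n)) (j : Fin m) (t : ℝ) (k : Fin m) :
    ∑ i, x i * (A + constCol n j t) i k = (∑ i, x i * A i k) + if k = j then t else 0 := by
  simp only [Matrix.add_apply, constCol, mul_add, Finset.sum_add_distrib, ← Finset.sum_mul,
    hx.2, one_mul]

theorem pay_add_constCol {n m : ℕ} (A : Matrix (Fin n) (Fin m) ℝ) {x : Fin n → ℝ}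
    (hx : x ∈ stdSimplex ℝ (Fin n)) (y : Fin m → ℝ) (j : Fin m) (t : ℝ) :
    pay (A + constCol n j t) x y = pay A x y + y j * t := by
  simp only [pay_eq_sum_col, col_add_constCol A hx, mul_add, Finset.sum_add_distrib, mul_ite,
    mul_zero, Finset.sum_ite_eq', Finset.mem_univ, if_true]

/-- Raising an unplayed column without making it profitable keeps the equilibrium. -/
theorem IsSaddle.add_constCol {n m : ℕ} {A : Matrix (Fin n) (Fin m) ℝ} {xs : Fin n → ℝ}
    {ys : Fin m → ℝ} (h : IsSaddle A xs ys) {j : Fin m} (hj : ys j = 0) {t : ℝ}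
    (ht : (∑ i, xs i * A i j) + t ≤ pay A xs ys) : IsSaddle (A + constCol n j t) xs ys := by
  refine ⟨h.1, h.2.1, fun x hx y hy => ?_⟩
  rw [pay_add_constCol A h.1 ys, pay_add_constCol A hx ys, hj, zero_mul, add_zero, add_zero]
  refine ⟨?_, (h.2.2 x hx y hy).2⟩
  rw [pay_eq_sum_col (A + constCol n j t)]
  calc ∑ k, y k * ∑ i, xs i * (A + constCol n j t) i k
      ≤ ∑ k, y k * pay A xs ys := by
        refine Finset.sum_le_sum fun k _ => mul_le_mul_of_nonneg_left ?_ (hy.1 k)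
        rw [col_add_constCol A h.1]
        split_ifs with hk
        · rwa [hk]
        · simpa using h.col_le k
    _ = pay A xs ys := by rw [← Finset.sum_mul, hy.2, one_mul]

theorem sum_filter_pos_mul {ι : Type*} [Fintype ι] {x : ι → ℝ} (hx : ∀ i, 0 ≤ x i)
    (f : ι → ℝ) : ∑ i ∈ Finset.univ.filter (fun i => 0 < x i), x i * f i = ∑ i, x i * f i :=
  Finset.sum_filter_of_ne fun i _ hi => (hx i).lt_of_ne' (left_ne_zero_of_mul hi)

/-- if the non-degenerate game `A` (with equilibrium `(x*, y*)`,
supports `B`, `N`, and `N̄ ≠ ∅`) is `δ`-support-stable — every `A'` with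
`‖A − A'‖ ≤ δ` in spectral norm is non-degenerate with the same equilibrium
supports — then `δ ≤ √n · β_P(A)` where
`β_P(A) = min_{j∈N̄} (v − ⟨x*_B, A_{B,j}⟩)`. -/
theorem stmt_17 (n m : ℕ) (A : Matrix (Fin n) (Fin m) ℝ)
    (xs : Fin n → ℝ) (ys : Fin m → ℝ)
    (hnd : NonDegenerate A xs ys)
    (hN : ∃ j, ¬ 0 < ys j)
    (δ : ℝ) (hδ : 0 < δ)
    (hstable : ∀ A' : Matrix (Fin n) (Fin m) ℝ, specNorm (A - A') ≤ δ →
      ∃ xs' ys', NonDegenerate A' xs' ys' ∧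
        {i | 0 < xs' i} = {i | 0 < xs i} ∧ {j | 0 < ys' j} = {j | 0 < ys j}) :
    δ ≤ Real.sqrt n *
      minD (Finset.univ.filter fun j : Fin m => ¬ 0 < ys j) (fun j =>
        pay A xs ys - ∑ i ∈ Finset.univ.filter (fun i : Fin n => 0 < xs i), xs i * A i j) := by
  have hne : (Finset.univ.filter fun j : Fin m => ¬ 0 < ys j).Nonempty := by
    simpa [Finset.Nonempty] using hN
  rw [minD, dif_pos hne]
  obtain ⟨j, hjmem, hj⟩ := Finset.exists_mem_eq_inf' hne (fun j =>
    pay A xs ys - ∑ i ∈ Finset.univ.filter (fun i : Fin n => 0 < xs i), xs i * A i j)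
  have hs := hnd.1
  rw [hj, sum_filter_pos_mul hs.1.1]
  have hyj : ys j = 0 := le_antisymm (not_lt.1 (Finset.mem_filter.1 hjmem).2) (hs.2.1.1 j)
  set t := pay A xs ys - ∑ i, xs i * A i j with ht
  by_contra! hlt
  have ht0 : 0 ≤ t := sub_nonneg.2 (hs.col_le j)
  obtain ⟨xs', ys', hnd', -, -⟩ := hstable (A + constCol n j t) (by
    rw [sub_add_cancel_left]
    exact (specNorm_neg_constCol_le n j ht0).trans hlt.le)
  obtain ⟨rfl, rfl⟩ := hnd'.2.1 xs ys (hs.add_constCol hyj (by rw [ht]; linarith))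
  refine hnd'.ne_zero_of_col_eq (j := j) ?_ hyj
  rw [col_add_constCol A hs.1, pay_add_constCol A hs.1, hyj, if_pos rfl, ht]
  ring

end
end
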